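/- The ℂ-vector space S_B of homogeneous polynomials of degree 6 in ℂ[x₁,x₂,x₃] whose Hessian matrix vanishes at all four points (0,0,1), (0,1,0), (1,0,0), (1,1,1) has dimension 4 over ℂ. -/

import Mathlib

open MvPolynomial

noncomputable section

/-- The Hessian matrix of `f` (the matrix of second partial derivatives) vanishes at `p`. -/
def HessVanishesAt (f : MvPolynomial (Fin 3) ℂ) (p : Fin 3 → ℂ) : Prop :=
  ∀ i j : Fin 3, eval p (pderiv i (pderiv j f)) = 0

/-- The four points `[0:0:1]`, `[0:1:0]`, `[1:0:0]`, `[1:1:1]` of `ℙ²` in general position. -/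
def Bpts : Set (Fin 3 → ℂ) := {![0,0,1], ![0,1,0], ![1,0,0], ![1,1,1]}

/-- Polynomials whose Hessian matrix vanishes at every point of `Bpts`. -/
def hessSubmodule : Submodule ℂ (MvPolynomial (Fin 3) ℂ) where
  carrier := {f | ∀ p ∈ Bpts, HessVanishesAt f p}
  zero_mem' := by intro p _ i j; simp
  add_mem' := by
    intro a b ha hb p hp i j
    have h1 := ha p hp i j
    have h2 := hb p hp i j
    simp only [map_add]
    rw [h1, h2, add_zero]
  smul_mem' := by
    intro c f hf p hp i j
    have h := hf p hp i j
    rw [Derivation.map_smul, Derivation.map_smul, smul_eq_C_mul, map_mul, eval_C, h, mul_zero]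

/-- `S_B`: homogeneous polynomials of degree 6 whose Hessian matrix vanishes at the four
points of `Bpts`. -/
def SB : Submodule ℂ (MvPolynomial (Fin 3) ℂ) :=
  homogeneousSubmodule (Fin 3) ℂ 6 ⊓ hessSubmodule

/-- A product of three polynomials vanishing at `p` has vanishing Hessian at `p`. -/
lemma HessVanishesAt.mul_mul {a b c : MvPolynomial (Fin 3) ℂ} {p : Fin 3 → ℂ}
    (ha : eval p a = 0) (hb : eval p b = 0) (hc : eval p c = 0) :
    HessVanishesAt (a * b * c) p := by
  intro i j
  simp [Derivation.leibniz, ha, hb, hc]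

/-- The first generator of the pencil of conics through the points of `Bpts`. -/
def conicLeft : MvPolynomial (Fin 3) ℂ := X 0 * (X 1 - X 2)

/-- The second generator of the pencil of conics through the points of `Bpts`. -/
def conicRight : MvPolynomial (Fin 3) ℂ := X 1 * (X 0 - X 2)

lemma isHomogeneous_conicLeft : conicLeft.IsHomogeneous 2 :=
  (isHomogeneous_X ℂ 0).mul ((isHomogeneous_X ℂ 1).sub (isHomogeneous_X ℂ 2))

lemma isHomogeneous_conicRight : conicRight.IsHomogeneous 2 :=
  (isHomogeneous_X ℂ 1).mul ((isHomogeneous_X ℂ 0).sub (isHomogeneous_X ℂ 2))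

lemma eval_conicLeft_of_mem {p : Fin 3 → ℂ} (hp : p ∈ Bpts) : eval p conicLeft = 0 := by
  rcases hp with rfl | rfl | rfl | rfl <;> simp [conicLeft]

lemma eval_conicRight_of_mem {p : Fin 3 → ℂ} (hp : p ∈ Bpts) : eval p conicRight = 0 := by
  rcases hp with rfl | rfl | rfl | rfl <;> simp [conicRight]

lemma mul_mul_mem_SB {a b c : MvPolynomial (Fin 3) ℂ} (ha : a.IsHomogeneous 2)
    (hb : b.IsHomogeneous 2) (hc : c.IsHomogeneous 2) (ha' : ∀ p ∈ Bpts, eval p a = 0)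
    (hb' : ∀ p ∈ Bpts, eval p b = 0) (hc' : ∀ p ∈ Bpts, eval p c = 0) :
    a * b * c ∈ SB :=
  ⟨(mem_homogeneousSubmodule 6 _).2 ((ha.mul hb).mul hc),
    fun p hp => HessVanishesAt.mul_mul (ha' p hp) (hb' p hp) (hc' p hp)⟩

/-- The cubic monomials in the two conics. -/
def conicCubics : Fin 4 → MvPolynomial (Fin 3) ℂ :=
  ![conicLeft * conicLeft * conicLeft, conicLeft * conicLeft * conicRight,
    conicLeft * conicRight * conicRight, conicRight * conicRight * conicRight]

lemma conicCubics_mem_SB (i : Fin 4) : conicCubics i ∈ SB := by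
  have hl := isHomogeneous_conicLeft
  have hr := isHomogeneous_conicRight
  have hl' := fun p (hp : p ∈ Bpts) => eval_conicLeft_of_mem hp
  have hr' := fun p (hp : p ∈ Bpts) => eval_conicRight_of_mem hp
  fin_cases i
  · exact mul_mul_mem_SB hl hl hl hl' hl' hl'
  · exact mul_mul_mem_SB hl hl hr hl' hl' hr'
  · exact mul_mul_mem_SB hl hr hr hl' hr' hr'
  · exact mul_mul_mem_SB hr hr hr hr' hr' hr'

lemma linearIndependent_conicCubics : LinearIndependent ℂ conicCubics := by
  rw [Fintype.linearIndependent_iff]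
  intro g hg
  have key (p : Fin 3 → ℂ) := congrArg (eval p) hg
  simp only [Fin.sum_univ_four, conicCubics, conicLeft, conicRight, map_add, smul_eval, map_mul,
    map_sub, eval_X, map_zero, Matrix.cons_val] at key
  have h₀ := key ![1, 0, 1]
  have h₃ := key ![0, 1, 1]
  have h₁ := key ![1, 1, 0]
  have h₂ := key ![1, 2, -1]
  simp only [Matrix.cons_val] at h₀ h₁ h₂ h₃
  intro i
  fin_cases i <;> simp only [Fin.zero_eta, Fin.mk_one, Fin.reduceFinMk] <;> grind

/-- A ternary form is the sum of its monomials, indexed by the first two exponents. -/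
lemma MvPolynomial.IsHomogeneous.exists_eq_sum_fin_three {R : Type*} [CommSemiring R] {n : ℕ}
    {f : MvPolynomial (Fin 3) R} (hf : f.IsHomogeneous n) :
    ∃ a : ℕ → ℕ → R, f = ∑ i ∈ Finset.range (n + 1), ∑ j ∈ Finset.range (n + 1 - i),
      C (a i j) * (X 0 ^ i * X 1 ^ j * X 2 ^ (n - i - j)) := by
  let e (s : Σ _ : ℕ, ℕ) : Fin 3 →₀ ℕ := Finsupp.equivFunOnFinite.symm ![s.1, s.2, n - s.1 - s.2]
  refine ⟨fun i j => coeff (e ⟨i, j⟩) f, ?_⟩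
  have hmon (s : Σ _ : ℕ, ℕ) : C (coeff (e s) f) * (X 0 ^ s.1 * X 1 ^ s.2 * X 2 ^ (n - s.1 - s.2))
      = monomial (e s) (coeff (e s) f) := by
    rw [monomial_eq, Finsupp.prod_fintype _ _ (fun i => pow_zero _), Fin.prod_univ_three]
    simp [e]
  rw [Finset.sum_sigma' (Finset.range (n + 1)) (fun i => Finset.range (n + 1 - i))
    (fun i j => C (coeff (e ⟨i, j⟩) f) * (X 0 ^ i * X 1 ^ j * X 2 ^ (n - i - j)))]
  conv_lhs => rw [f.as_sum]
  symm
  refine Finset.sum_bij_ne_zero (fun s _ _ => e s) ?_ ?_ ?_ ?_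
  · intro s _ hs
    rw [mem_support_iff]
    intro h
    simp [h] at hs
  · intro s _ _ t _ _ h
    have h0 := DFunLike.congr_fun h 0
    have h1 := DFunLike.congr_fun h 1
    obtain ⟨i, j⟩ := s
    obtain ⟨k, l⟩ := t
    simp only [e, Finsupp.equivFunOnFinite_symm_apply_apply, Matrix.cons_val] at h0 h1
    rw [h0, h1]
  · intro d hd hd0
    have hdeg : d 0 + d 1 + d 2 = n := by
      have := hf (mem_support_iff.1 hd)
      simpa [Finsupp.weight_apply, Finsupp.sum_fintype, Fin.sum_univ_three] using this
    have hed : e ⟨d 0, d 1⟩ = d := by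
      ext k
      fin_cases k <;> simp [e]
      omega
    refine ⟨⟨d 0, d 1⟩, ?_, ?_, hed⟩
    · simp only [Finset.mem_sigma, Finset.mem_range]
      omega
    · rw [hmon ⟨d 0, d 1⟩, hed]
      exact hd0
  · intro s _ _
    exact hmon s

section Pderiv

variable {R : Type*} [CommSemiring R] (a : R) (i j k : ℕ)

lemma pderiv_zero_C_mul : pderiv (0 : Fin 3) (C a * (X 0 ^ i * X 1 ^ j * X 2 ^ k)) =
    C (a * i) * (X 0 ^ (i - 1) * X 1 ^ j * X 2 ^ k) := by
  simp [Derivation.leibniz, Derivation.leibniz_pow, pderiv_X]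
  ring

lemma pderiv_one_C_mul : pderiv (1 : Fin 3) (C a * (X 0 ^ i * X 1 ^ j * X 2 ^ k)) =
    C (a * j) * (X 0 ^ i * X 1 ^ (j - 1) * X 2 ^ k) := by
  simp [Derivation.leibniz, Derivation.leibniz_pow, pderiv_X]
  ring

lemma pderiv_two_C_mul : pderiv (2 : Fin 3) (C a * (X 0 ^ i * X 1 ^ j * X 2 ^ k)) =
    C (a * k) * (X 0 ^ i * X 1 ^ j * X 2 ^ (k - 1)) := by
  simp [Derivation.leibniz, Derivation.leibniz_pow, pderiv_X]
  ring

end Pderiv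

set_option maxHeartbeats 4000000 in
lemma SB_le_span_conicCubics : SB ≤ Submodule.span ℂ (Set.range conicCubics) := by
  rintro f ⟨hf, hB⟩
  have hess (p : Fin 3 → ℂ) (hp : p ∈ Bpts) (i j : Fin 3) :
      eval p (pderiv i (pderiv j f)) = 0 := hB p hp i j
  obtain ⟨a, rfl⟩ := IsHomogeneous.exists_eq_sum_fin_three ((mem_homogeneousSubmodule 6 f).1 hf)
  have key (p : Fin 3 → ℂ) (hp : p ∈ Bpts) := And.intro (hess p hp 0 0) <|
    And.intro (hess p hp 1 1) <| And.intro (hess p hp 2 2) <| And.intro (hess p hp 0 1) <|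
    And.intro (hess p hp 0 2) (hess p hp 1 2)
  simp only [map_sum, pderiv_zero_C_mul, pderiv_one_C_mul, pderiv_two_C_mul] at key
  simp only [map_mul, map_pow, eval_C, eval_X] at key
  have hz := key ![0, 0, 1] (by simp [Bpts])
  have hy := key ![0, 1, 0] (by simp [Bpts])
  have hx := key ![1, 0, 0] (by simp [Bpts])
  have hu := key ![1, 1, 1] (by simp [Bpts])
  clear hf hB key hess
  simp [Finset.sum_range_succ] at hx hy hz
  simp [Finset.sum_range_succ, hx, hy, hz] at hu ⊢
  clear hx hy hz
  obtain ⟨h₁, h₂, h₃, h₄, h₅, h₆⟩ := hu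
  obtain ⟨c₀, hc₀⟩ : ∃ c, c = -a 3 0 := ⟨_, rfl⟩
  obtain ⟨c₁, hc₁⟩ : ∃ c, c = -a 2 1 := ⟨_, rfl⟩
  obtain ⟨c₂, hc₂⟩ : ∃ c, c = -a 1 2 := ⟨_, rfl⟩
  obtain ⟨c₃, hc₃⟩ : ∃ c, c = -a 0 3 := ⟨_, rfl⟩
  have e₃₀ : a 3 0 = -c₀ := by grind
  have e₂₁ : a 2 1 = -c₁ := by grind
  have e₁₂ : a 1 2 = -c₂ := by grind
  have e₀₃ : a 0 3 = -c₃ := by grind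
  have e₃₁ : a 3 1 = 3 * c₀ + c₁ := by grind
  have e₃₂ : a 3 2 = -(3 * c₀ + 2 * c₁ + c₂) := by grind
  have e₃₃ : a 3 3 = c₀ + c₁ + c₂ + c₃ := by grind
  have e₂₂ : a 2 2 = 2 * c₁ + 2 * c₂ := by grind
  have e₂₃ : a 2 3 = -(c₁ + 2 * c₂ + 3 * c₃) := by grind
  have e₁₃ : a 1 3 = c₂ + 3 * c₃ := by grind
  rw [Submodule.mem_span_range_iff_exists_fun]
  refine ⟨![c₀, c₁, c₂, c₃], ?_⟩
  simp only [e₃₀, e₂₁, e₁₂, e₀₃, e₃₁, e₃₂, e₃₃, e₂₂, e₂₃, e₁₃, Fin.sum_univ_four, conicCubics,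
    conicLeft, conicRight, Matrix.cons_val, smul_eq_C_mul, map_add, map_neg, map_mul, map_ofNat]
  ring

/-- The space `S_B` of homogeneous polynomials of degree 6 in `ℂ[x₁,x₂,x₃]` whose Hessian
matrix vanishes at the four points `(0,0,1)`, `(0,1,0)`, `(1,0,0)`, `(1,1,1)` has
dimension 4 over `ℂ`. -/
theorem finrank_SB_eq_four : Module.finrank ℂ SB = 4 := by
  have h : SB = Submodule.span ℂ (Set.range conicCubics) := by
    refine le_antisymm SB_le_span_conicCubics (Submodule.span_le.2 ?_)
    rintro _ ⟨i, rfl⟩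
    exact conicCubics_mem_SB i
  rw [h, finrank_span_eq_card linearIndependent_conicCubics, Fintype.card_fin]
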